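/- For every ε > 0 and every n ∈ ℕ₊ there exists δ > 0 such that for all d ∈ ℕ₊: if 𝒜 = (A₁, …, Aₙ) is a ∗-closed δ-commuting tuple of d×d complex matrices, then there exists a commuting tuple ℬ = (B₁, …, Bₙ) of d×d complex matrices with d_rank(𝒜, ℬ) ≤ ε. -/

import Mathlib

open Matrix

/-- The normalized rank of a square matrix: `dim_ℂ(im A) / d`. -/
noncomputable def nrank {d : ℕ} (A : Matrix (Fin d) (Fin d) ℂ) : ℝ :=
  (A.rank : ℝ) / d

/-- A tuple of matrices is `∗`-closed if it is closed under taking conjugate transposes. -/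
def StarClosed {n d : ℕ} (A : Fin n → Matrix (Fin d) (Fin d) ℂ) : Prop :=
  ∀ i, ∃ j, (A i)ᴴ = A j

/-- A tuple of matrices is `δ`-commuting if all normalized ranks of commutators are `≤ δ`. -/
def DeltaCommuting {n d : ℕ} (δ : ℝ) (A : Fin n → Matrix (Fin d) (Fin d) ℂ) : Prop :=
  ∀ i j, nrank (A i * A j - A j * A i) ≤ δ


noncomputable def cert {σ : Type} (S : Set (MvPolynomial σ ℂ)) (D : ℕ) : Submodule ℂ (MvPolynomial σ ℂ) :=
  Submodule.span ℂ {h | ∃ g : MvPolynomial σ ℂ, ∃ f ∈ S, h = g * f ∧ g.totalDegree ≤ D}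

lemma cert_mono {σ : Type} (S : Set (MvPolynomial σ ℂ)) {D D' : ℕ} (h : D ≤ D') :
    cert S D ≤ cert S D' := by
  apply Submodule.span_mono
  rintro x ⟨g, f, hf, rfl, hg⟩
  exact ⟨g, f, hf, rfl, hg.trans h⟩

lemma cert_mul {σ : Type} (S : Set (MvPolynomial σ ℂ)) {D E : ℕ} {g q : MvPolynomial σ ℂ}
    (hg : g.totalDegree ≤ E) (hq : q ∈ cert S D) : g * q ∈ cert S (E + D) := by
  unfold cert at hq
  induction hq using Submodule.span_induction with
  | mem x hx =>
    obtain ⟨g', f, hf, rfl, hg'⟩ := hx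
    refine Submodule.subset_span ⟨g * g', f, hf, by ring, ?_⟩
    exact (MvPolynomial.totalDegree_mul _ _).trans (by omega)
  | zero => simp
  | add x y _ _ hx hy => rw [mul_add]; exact Submodule.add_mem _ hx hy
  | smul a x _ hx => rw [mul_smul_comm]; exact Submodule.smul_mem _ _ hx

lemma germ_algClosed (U : Ultrafilter ℕ) : IsAlgClosed (Filter.Germ (U : Filter ℕ) ℂ) := by
  apply IsAlgClosed.of_exists_root
  intro p hp hirr
  have hsurj : Function.Surjective (Filter.Germ.coeRingHom (R := ℂ) (U : Filter ℕ)) := by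
    intro x
    induction x using Filter.Germ.inductionOn with
    | _ f => exact ⟨f, rfl⟩
  have hl : p ∈ Polynomial.lifts (Filter.Germ.coeRingHom (R := ℂ) (U : Filter ℕ)) := by
    rw [Polynomial.mem_lifts]
    exact Polynomial.map_surjective _ hsurj p
  obtain ⟨q, hq, hdeg, hmon⟩ := Polynomial.lifts_and_natDegree_eq_and_monic hl hp
  have hpos : 0 < p.natDegree := hirr.natDegree_pos
  have hroot : ∀ k : ℕ, ∃ z : ℂ, (q.map (Pi.evalRingHom (fun _ : ℕ => ℂ) k)).eval z = 0 := by
    intro k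
    have hm := hmon.map (Pi.evalRingHom (fun _ : ℕ => ℂ) k)
    have : (q.map (Pi.evalRingHom (fun _ : ℕ => ℂ) k)).degree ≠ 0 := by
      rw [hmon.degree_map, Polynomial.degree_eq_natDegree hmon.ne_zero, hdeg]
      exact_mod_cast hpos.ne'
    obtain ⟨z, hz⟩ := IsAlgClosed.exists_root _ this
    exact ⟨z, hz⟩
  choose z hz using hroot
  refine ⟨Filter.Germ.coeRingHom (R := ℂ) (U : Filter ℕ) z, ?_⟩
  rw [← hq, Polynomial.eval_map, Polynomial.eval₂_hom]
  have : Polynomial.eval z q = 0 := by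
    ext k
    have := hz k
    rw [Polynomial.eval_map] at this
    have h2 := Polynomial.eval₂_hom (p := q) (Pi.evalRingHom (fun _ : ℕ => ℂ) k) z
    simp only [Pi.evalRingHom_apply] at h2
    rw [Pi.zero_apply, ← h2]; exact this
  rw [this, map_zero]

/-- internal polynomial -/
lemma exists_internal {σ : Type} [Finite σ] (r : ℕ) (f : ℕ → MvPolynomial σ ℂ)
    (hf : ∀ k, (f k).totalDegree ≤ r) :
    ∃ F : MvPolynomial σ (ℕ → ℂ), ∀ k, MvPolynomial.map (Pi.evalRingHom (fun _ : ℕ => ℂ) k) F = f k := by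
  classical
  have hfin : {α : σ →₀ ℕ | α.degree ≤ r}.Finite := Finsupp.finite_of_degree_le r
  refine ⟨∑ α ∈ hfin.toFinset, MvPolynomial.monomial α (fun k => (f k).coeff α), fun k => ?_⟩
  rw [map_sum]
  simp only [MvPolynomial.map_monomial, Pi.evalRingHom_apply]
  ext β
  simp only [MvPolynomial.coeff_sum, MvPolynomial.coeff_monomial, Finset.sum_ite_eq']
  split_ifs with h
  · rfl
  · symm
    by_contra hne
    apply h
    have := MvPolynomial.le_totalDegree (MvPolynomial.mem_support_iff.2 hne)
    simp only [Set.Finite.mem_toFinset, Set.mem_ofPred_eq]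
    exact le_trans this (hf k)

lemma effNS (σ : Type) [Finite σ] (r : ℕ) : ∃ D : ℕ, ∀ (S : Set (MvPolynomial σ ℂ))
    (p : MvPolynomial σ ℂ), (∀ f ∈ S, f.totalDegree ≤ r) → p.totalDegree ≤ r →
    (∀ z : σ → ℂ, (∀ f ∈ S, MvPolynomial.eval z f = 0) → MvPolynomial.eval z p = 0) →
    ∃ m ≤ D, p ^ m ∈ cert S D := by
  classical
  by_contra hcon
  push Not at hcon
  choose S p hS hp hz hbad using hcon
  let U : Ultrafilter ℕ := Filter.hyperfilter ℕ
  let π := Filter.Germ.coeRingHom (R := ℂ) (U : Filter ℕ)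
  let ev := fun k => Pi.evalRingHom (fun _ : ℕ => ℂ) k
  have := germ_algClosed U
  have hsurj : Function.Surjective π := by
    intro x
    induction x using Filter.Germ.inductionOn with
    | _ f => exact ⟨f, rfl⟩
  have hπ0 : ∀ a, π a = 0 ↔ ∀ᶠ k in (U : Filter ℕ), a k = 0 := by
    intro a
    exact Filter.Germ.coe_eq (f := a) (g := 0)
  have hev : ∀ (w : σ → ℕ → ℂ) (F : MvPolynomial σ (ℕ → ℂ)) (k : ℕ),
      (MvPolynomial.eval w F) k = MvPolynomial.eval (fun i => w i k) (MvPolynomial.map (ev k) F) := by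
    intro w F k
    rw [MvPolynomial.eval_map]
    have := MvPolynomial.eval₂_comp_left (ev k) (RingHom.id _) w F
    exact this
  have hevπ : ∀ (w : σ → ℕ → ℂ) (F : MvPolynomial σ (ℕ → ℂ)),
      MvPolynomial.eval (fun i => π (w i)) (MvPolynomial.map π F) = π (MvPolynomial.eval w F) := by
    intro w F
    rw [MvPolynomial.eval_map]
    exact (MvPolynomial.eval₂_comp_left π (RingHom.id _) w F).symm
  obtain ⟨P, hP⟩ := exists_internal r p hp
  let T : Set (MvPolynomial σ (Filter.Germ (U : Filter ℕ) ℂ)) :=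
    {q | ∃ F : MvPolynomial σ (ℕ → ℂ), (∀ᶠ k in (U : Filter ℕ), MvPolynomial.map (ev k) F ∈ S k) ∧ q = MvPolynomial.map π F}
  have hrad : MvPolynomial.map π P ∈ (Ideal.span T).radical := by
    rw [← MvPolynomial.vanishingIdeal_zeroLocus_eq_radical (K := Filter.Germ (U : Filter ℕ) ℂ), MvPolynomial.zeroLocus_span]
    intro x hx
    simp only [Set.mem_ofPred_eq] at hx
    choose w hw using fun i => hsurj (x i)
    obtain rfl : (fun i => π (w i)) = x := funext hw
    rw [MvPolynomial.aeval_eq_eval, hevπ, hπ0]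
    have key : ∀ᶠ k in (U : Filter ℕ), ∀ f ∈ S k, MvPolynomial.eval (fun i => w i k) f = 0 := by
      by_contra hne
      rw [← Ultrafilter.eventually_not] at hne
      have : ∀ k, ∃ f : MvPolynomial σ ℂ, f.totalDegree ≤ r ∧
          ((¬ ∀ f ∈ S k, MvPolynomial.eval (fun i => w i k) f = 0) → f ∈ S k ∧ MvPolynomial.eval (fun i => w i k) f ≠ 0) := by
        intro k
        by_cases h : ∀ f ∈ S k, MvPolynomial.eval (fun i => w i k) f = 0
        · exact ⟨0, by simp, fun h' => absurd h h'⟩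
        · have h' := h
          push Not at h'
          obtain ⟨f, hf, hf'⟩ := h'
          exact ⟨f, hS k f hf, fun _ => ⟨hf, hf'⟩⟩
      choose f hfr hf using this
      obtain ⟨F, hF⟩ := exists_internal r f hfr
      have h0 := hx (MvPolynomial.map π F) ⟨F, by
        filter_upwards [hne] with k hk
        rw [hF]; exact (hf k hk).1, rfl⟩
      rw [MvPolynomial.aeval_eq_eval, hevπ, hπ0] at h0
      obtain ⟨k, hk1, hk2⟩ := (hne.and h0).exists
      rw [hev, hF] at hk2
      exact (hf k hk1).2 hk2
    filter_upwards [key] with k hk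
    rw [hev, hP]
    exact hz k _ hk
  obtain ⟨m, hm⟩ := hrad
  have hlift : ∀ q ∈ Ideal.span T, ∃ Q : MvPolynomial σ (ℕ → ℂ), MvPolynomial.map π Q = q ∧
      ∃ D, ∀ᶠ k in (U : Filter ℕ), MvPolynomial.map (ev k) Q ∈ cert (S k) D := by
    intro q hq
    induction hq using Submodule.span_induction with
    | mem x hx =>
      obtain ⟨F, hF, rfl⟩ := hx
      refine ⟨F, rfl, 0, ?_⟩
      filter_upwards [hF] with k hk
      exact Submodule.subset_span ⟨1, _, hk, by simp, by simp⟩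
    | zero => exact ⟨0, by simp, 0, by simp⟩
    | add x y _ _ hx hy =>
      obtain ⟨Q, rfl, D, hD⟩ := hx
      obtain ⟨Q', rfl, D', hD'⟩ := hy
      refine ⟨Q + Q', by simp, max D D', ?_⟩
      filter_upwards [hD, hD'] with k hk hk'
      rw [map_add]
      exact Submodule.add_mem _ (cert_mono _ (le_max_left _ _) hk) (cert_mono _ (le_max_right _ _) hk')
    | smul a x _ hx =>
      obtain ⟨Q, rfl, D, hD⟩ := hx
      obtain ⟨G, rfl⟩ := MvPolynomial.map_surjective π hsurj a
      refine ⟨G * Q, by simp, G.totalDegree + D, ?_⟩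
      filter_upwards [hD] with k hk
      rw [map_mul]
      refine cert_mul _ ?_ hk
      exact Finset.sup_mono (MvPolynomial.support_map_subset _ _)
  obtain ⟨Q, hQ, D, hD⟩ := hlift _ hm
  have hz0 : MvPolynomial.map π (P ^ m - Q) = 0 := by
    rw [map_sub, hQ, map_pow, sub_self]
  have hev0 : ∀ᶠ k in (U : Filter ℕ), MvPolynomial.map (ev k) (P ^ m - Q) = 0 := by
    have : ∀ᶠ k in (U : Filter ℕ), ∀ α ∈ (P ^ m - Q).support, (P ^ m - Q).coeff α k = 0 := by
      rw [Filter.eventually_all_finset]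
      intro α _
      rw [← hπ0]
      have := congrArg (MvPolynomial.coeff α) hz0
      rwa [MvPolynomial.coeff_map, MvPolynomial.coeff_zero] at this
    filter_upwards [this] with k hk
    ext α
    rw [MvPolynomial.coeff_map, MvPolynomial.coeff_zero]
    by_cases h : α ∈ (P ^ m - Q).support
    · exact hk α h
    · rw [MvPolynomial.notMem_support_iff.1 h]; simp
  have hlarge : ∀ᶠ k in (U : Filter ℕ), max D m ≤ k := by
    have h1 : (U : Filter ℕ) ≤ Filter.atTop := by
      rw [← Nat.cofinite_eq_atTop]; exact Filter.hyperfilter_le_cofinite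
    exact h1 (Filter.eventually_ge_atTop _)
  obtain ⟨k, ⟨hk1, hk2⟩, hk3⟩ := ((hD.and hev0).and hlarge).exists
  rw [map_sub, map_pow, hP, sub_eq_zero] at hk2
  refine hbad k m (le_trans (le_max_right _ _) hk3) ?_
  rw [hk2]
  exact cert_mono _ (le_trans (le_max_left _ _) hk3) hk1
section loc
variable {σ : Type} {H : Type} [NormedAddCommGroup H] [InnerProductSpace ℂ H]

noncomputable def wd (A : σ → Module.End ℂ H) (l : List σ) : Module.End ℂ H := (l.map A).prod

noncomputable def MM (A : σ → Module.End ℂ H) : MvPolynomial σ ℂ →ₗ[ℂ] Module.End ℂ H :=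
  (MvPolynomial.basisMonomials σ ℂ).constr ℂ (fun α => wd A (Finsupp.toMultiset α).toList)

lemma MM_monomial (A : σ → Module.End ℂ H) (α : σ →₀ ℕ) (c : ℂ) :
    MM A (MvPolynomial.monomial α c) = c • wd A (Finsupp.toMultiset α).toList := by
  have h1 : MM A (MvPolynomial.monomial α 1) = wd A (Finsupp.toMultiset α).toList := by
    have := (MvPolynomial.basisMonomials σ ℂ).constr_basis ℂ (fun α => wd A (Finsupp.toMultiset α).toList) α
    rwa [MvPolynomial.coe_basisMonomials] at this
  rw [← h1, ← map_smul, MvPolynomial.smul_monomial, smul_eq_mul, mul_one]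

lemma MM_one (A : σ → Module.End ℂ H) : MM A 1 = 1 := by
  have : (1 : MvPolynomial σ ℂ) = MvPolynomial.monomial 0 1 := rfl
  rw [this, MM_monomial]; simp [wd]

def Good (A : σ → Module.End ℂ H) (R : ℕ) (v : H) : Prop :=
  ∀ i (α : σ →₀ ℕ), α.degree < R →
    MM A (MvPolynomial.X i * MvPolynomial.monomial α 1) v = A i (MM A (MvPolynomial.monomial α 1) v)

/-- induction over monomials with degree bound -/
lemma poly_ind {P : MvPolynomial σ ℂ → Prop} (n : ℕ) (h0 : P 0)
    (hadd : ∀ p q, P p → P q → P (p + q))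
    (hm : ∀ α c, Finsupp.degree α ≤ n → P (MvPolynomial.monomial α c))
    (p : MvPolynomial σ ℂ) (hp : p.totalDegree ≤ n) : P p := by
  rw [MvPolynomial.as_sum p]
  apply Finset.sum_induction _ _ (fun a b => hadd a b) h0
  intro α hα
  exact hm _ _ ((MvPolynomial.le_totalDegree hα).trans hp)

lemma good_X {A : σ → Module.End ℂ H} {R : ℕ} {v : H} (hv : Good A R v) (i : σ)
    (p : MvPolynomial σ ℂ) (hp : p.totalDegree < R) :
    MM A (MvPolynomial.X i * p) v = A i (MM A p v) := by
  refine poly_ind (R - 1) (P := fun p => MM A (MvPolynomial.X i * p) v = A i (MM A p v))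
    ?_ ?_ ?_ p (by omega)
  · simp
  · intro p q hp hq
    simp only [mul_add, map_add, LinearMap.add_apply, hp, hq]
  · intro α c hα
    have h := hv i α (by omega)
    have hc : (MvPolynomial.monomial α c : MvPolynomial σ ℂ) = c • MvPolynomial.monomial α 1 := by
      rw [MvPolynomial.smul_monomial, smul_eq_mul, mul_one]
    rw [hc, mul_smul_comm, map_smul, map_smul, LinearMap.smul_apply, LinearMap.smul_apply, h, map_smul]

lemma deg_list (l : List σ) : ((l.map (MvPolynomial.X (R := ℂ))).prod).totalDegree ≤ l.length := by
  induction l with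
  | nil => simp
  | cons a l ih =>
    simp only [List.map_cons, List.prod_cons, List.length_cons]
    refine (MvPolynomial.totalDegree_mul _ _).trans ?_
    rw [MvPolynomial.totalDegree_X]; omega

lemma good_list {A : σ → Module.End ℂ H} {R : ℕ} {v : H} (hv : Good A R v) (l : List σ)
    (p : MvPolynomial σ ℂ) (hp : l.length + p.totalDegree ≤ R) :
    MM A ((l.map MvPolynomial.X).prod * p) v = wd A l (MM A p v) := by
  induction l with
  | nil => simp [wd]
  | cons a l ih =>
    simp only [List.length_cons] at hp
    simp only [List.map_cons, List.prod_cons, wd, mul_assoc, Module.End.mul_apply]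
    have h := deg_list l
    have h2 := MvPolynomial.totalDegree_mul ((l.map (MvPolynomial.X (R := ℂ))).prod) p
    rw [good_X hv _ _ (by omega), ih (by omega)]; rfl

lemma mono_list (α : σ →₀ ℕ) : (MvPolynomial.monomial α 1 : MvPolynomial σ ℂ) =
    (((Finsupp.toMultiset α).toList).map MvPolynomial.X).prod := by
  classical
  have : (((Finsupp.toMultiset α).toList).map (MvPolynomial.X (R := ℂ))).prod
      = ((Finsupp.toMultiset α).map (MvPolynomial.X (R := ℂ))).prod := by
    conv_rhs => rw [← Multiset.coe_toList (Finsupp.toMultiset α)]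
    rw [Multiset.map_coe, Multiset.prod_coe]
  rw [this, Finsupp.toMultiset_map, Finsupp.prod_toMultiset]
  rw [MvPolynomial.monomial_eq, Finsupp.prod_mapDomain_index] <;> simp [pow_add]

lemma len_list (α : σ →₀ ℕ) : (Finsupp.toMultiset α).toList.length = α.degree := by
  rw [Multiset.length_toList, Finsupp.card_toMultiset, Finsupp.degree_apply]; rfl

lemma good_mul {A : σ → Module.End ℂ H} {R : ℕ} {v : H} (hv : Good A R v)
    (q p : MvPolynomial σ ℂ) (hp : q.totalDegree + p.totalDegree ≤ R) :
    MM A (q * p) v = MM A q (MM A p v) := by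
  refine poly_ind q.totalDegree (P := fun q => MM A (q * p) v = MM A q (MM A p v))
    ?_ ?_ ?_ q le_rfl
  · simp
  · intro p q hp hq
    simp only [add_mul, map_add, LinearMap.add_apply, hp, hq]
  · intro α c hα
    have hc : (MvPolynomial.monomial α c : MvPolynomial σ ℂ) = c • MvPolynomial.monomial α 1 := by
      rw [MvPolynomial.smul_monomial, smul_eq_mul, mul_one]
    rw [hc, smul_mul_assoc, map_smul, map_smul, MM_monomial, mono_list, one_smul, LinearMap.smul_apply,
      LinearMap.smul_apply, good_list hv _ _ (by rw [len_list]; omega)]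

lemma wd_adj {A : σ → Module.End ℂ H} (hA : ∀ i, (A i).IsSymmetric) (l : List σ) (x y : H) :
    inner ℂ (wd A l x) y = inner ℂ x (wd A l.reverse y) := by
  induction l generalizing x y with
  | nil => simp [wd]
  | cons a l ih =>
    have : wd A (a :: l) x = A a (wd A l x) := by simp [wd]
    rw [this, hA a, ih]
    simp [wd]

noncomputable def cj (p : MvPolynomial σ ℂ) : MvPolynomial σ ℂ := MvPolynomial.map (starRingEnd ℂ) p

lemma cj_deg (p : MvPolynomial σ ℂ) : (cj p).totalDegree ≤ p.totalDegree :=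
  Finset.sup_mono (MvPolynomial.support_map_subset _ _)

lemma inner_MM {A : σ → Module.End ℂ H} (hA : ∀ i, (A i).IsSymmetric) {R : ℕ} {v : H}
    (hv : Good A R v) (v' : H) (p q : MvPolynomial σ ℂ) (hpq : p.totalDegree + q.totalDegree ≤ R) :
    inner ℂ (MM A p v') (MM A q v) = inner ℂ v' (MM A (cj p * q) v) := by
  refine poly_ind p.totalDegree
    (P := fun p => inner ℂ (MM A p v') (MM A q v) = inner ℂ v' (MM A (cj p * q) v)) ?_ ?_ ?_ p le_rfl
  · simp [cj]
  · intro p p' h h'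
    simp only [cj, map_add, add_mul, LinearMap.add_apply, inner_add_left, inner_add_right] at *
    rw [h, h']
  · intro α c hα
    have hc : cj (MvPolynomial.monomial α c : MvPolynomial σ ℂ) =
        (starRingEnd ℂ c) • MvPolynomial.monomial α 1 := by
      rw [MvPolynomial.smul_monomial, smul_eq_mul, mul_one, cj, MvPolynomial.map_monomial]
    have hr : (MvPolynomial.monomial α 1 : MvPolynomial σ ℂ) =
      (((Finsupp.toMultiset α).toList.reverse).map MvPolynomial.X).prod := by
      rw [mono_list, List.map_reverse, List.prod_reverse]
    rw [hc, smul_mul_assoc, map_smul, LinearMap.smul_apply, inner_smul_right, hr,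
      good_list hv _ _ (by rw [List.length_reverse, len_list]; omega), MM_monomial,
      LinearMap.smul_apply, inner_smul_left, wd_adj hA]

lemma sq_zero {A : σ → Module.End ℂ H} (hA : ∀ i, (A i).IsSymmetric) {R : ℕ} {v : H}
    (hv : Good A R v) (p : MvPolynomial σ ℂ) (hp : 2 * p.totalDegree ≤ R)
    (h : MM A (cj p * p) v = 0) : MM A p v = 0 := by
  have := inner_MM hA hv v p p (by omega)
  rw [h, inner_zero_right] at this
  exact inner_self_eq_zero.1 this

lemma rad_zero {A : σ → Module.End ℂ H} (hA : ∀ i, (A i).IsSymmetric) {R r D m : ℕ} {v : H}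
    (hv : Good A R v) (p : MvPolynomial σ ℂ) (hp : p.totalDegree ≤ r) (hm : m ≤ D)
    (hR : 2 * r * 2 ^ D ≤ R) (h : MM A (p ^ m) v = 0) : MM A p v = 0 := by
  have hmD : 2 ^ m ≤ 2 ^ D := Nat.pow_le_pow_right (by norm_num) hm
  have hRm : 2 * r * 2 ^ m ≤ R := le_trans (Nat.mul_le_mul_left _ hmD) hR
  have h1 : 1 ≤ 2 ^ m := Nat.one_le_two_pow
  have hlt : m < 2 ^ m := Nat.lt_two_pow_self
  set h0 := cj p * p with hh0
  have hcj : cj h0 = h0 := by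
    rw [hh0, cj, map_mul, cj, MvPolynomial.map_map]
    have : (starRingEnd ℂ).comp (starRingEnd ℂ) = RingHom.id ℂ := by ext x; simp
    rw [this, MvPolynomial.map_id, mul_comm]
  have hdeg : h0.totalDegree ≤ 2 * r := by
    have := MvPolynomial.totalDegree_mul (cj p) p
    have := cj_deg p
    rw [hh0]
    omega
  have hpow : ∀ k ≤ m, MM A (h0 ^ (2 ^ k)) v = 0 → MM A h0 v = 0 := by
    intro k
    induction k with
    | zero => intro _ h; simpa using h
    | succ k ih =>
      intro hk h
      apply ih (by omega)
      apply sq_zero hA hv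
      · have e1 := MvPolynomial.totalDegree_pow h0 (2 ^ k)
        have e2 : 2 ^ k * h0.totalDegree ≤ 2 ^ k * (2 * r) := Nat.mul_le_mul_left _ hdeg
        have e3 : 2 ^ (k + 1) ≤ 2 ^ m := Nat.pow_le_pow_right (by norm_num) hk
        have e4 : 2 * r * 2 ^ (k+1) ≤ 2 * r * 2 ^ m := Nat.mul_le_mul_left _ e3
        rw [pow_succ] at e4
        nlinarith
      · have : cj (h0 ^ 2 ^ k) = h0 ^ 2 ^ k := by
          conv_rhs => rw [← hcj]
          rw [cj, map_pow]; rfl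
        rw [this, ← pow_add, ← two_mul, ← pow_succ']; exact h
  have hH : MM A h0 v = 0 := by
    apply hpow m le_rfl
    have : h0 ^ 2 ^ m = (cj p ^ 2 ^ m * p ^ (2 ^ m - m)) * p ^ m := by
      rw [mul_assoc, ← pow_add, Nat.sub_add_cancel hlt.le, hh0, mul_pow]
    rw [this, good_mul hv, h, map_zero]
    have e1 := MvPolynomial.totalDegree_mul (cj p ^ 2 ^ m) (p ^ (2 ^ m - m))
    have e2 := MvPolynomial.totalDegree_pow (cj p) (2 ^ m)
    have e3 := MvPolynomial.totalDegree_pow p (2 ^ m - m)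
    have e4 := MvPolynomial.totalDegree_pow p m
    have e5 : 2 ^ m * (cj p).totalDegree ≤ 2 ^ m * r := Nat.mul_le_mul_left _ ((cj_deg p).trans hp)
    have e6 : (2 ^ m - m) * p.totalDegree ≤ (2 ^ m - m) * r := Nat.mul_le_mul_left _ hp
    have e7 : m * p.totalDegree ≤ m * r := Nat.mul_le_mul_left _ hp
    have e8 : (2 ^ m - m) * r + m * r = 2 ^ m * r := by rw [← add_mul, Nat.sub_add_cancel hlt.le]
    have e9 : 2 * r * 2 ^ m = 2 ^ m * r + 2 ^ m * r := by ring
    omega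
  apply sq_zero hA hv p _ hH
  nlinarith

lemma cert_zero {A : σ → Module.End ℂ H} {R r D : ℕ} {v : H}
    (hv : Good A R v) (hR : D + r ≤ R) (q : MvPolynomial σ ℂ)
    (hq : q ∈ cert {f | f.totalDegree ≤ r ∧ MM A f v = 0} D) : MM A q v = 0 := by
  unfold cert at hq
  induction hq using Submodule.span_induction with
  | mem x hx =>
    obtain ⟨g, f, hf, rfl, hg⟩ := hx
    rw [good_mul hv, hf.2, map_zero]
    have := hf.1
    omega
  | zero => simp
  | add x y _ _ hx hy => rw [map_add, LinearMap.add_apply, hx, hy, add_zero]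
  | smul a x _ hx => rw [map_smul, LinearMap.smul_apply, hx, smul_zero]

lemma points (σ : Type) [Finite σ] (r : ℕ) : ∃ R : ℕ, ∀ (H : Type) [NormedAddCommGroup H] [InnerProductSpace ℂ H]
    (A : σ → Module.End ℂ H), (∀ i, (A i).IsSymmetric) → ∀ v, Good A R v →
    ∀ p : MvPolynomial σ ℂ, p.totalDegree ≤ r →
    (∀ z : σ → ℂ, (∀ f : MvPolynomial σ ℂ, f.totalDegree ≤ r → MM A f v = 0 → MvPolynomial.eval z f = 0) →
      MvPolynomial.eval z p = 0) → MM A p v = 0 := by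
  obtain ⟨D, hD⟩ := effNS σ r
  refine ⟨max (2 * r * 2 ^ D) (D + r), ?_⟩
  intro H _ _ A hA v hv p hp hz
  obtain ⟨m, hm, hc⟩ := hD {f | f.totalDegree ≤ r ∧ MM A f v = 0} p (fun f hf => hf.1) hp
    (fun z h => hz z fun f hf hf' => h f ⟨hf, hf'⟩)
  exact rad_zero hA hv p hp hm (le_max_left _ _) (cert_zero hv (le_max_right _ _) _ hc)

lemma good_mono {A : σ → Module.End ℂ H} {R R' : ℕ} (h : R ≤ R') {v : H} (hv : Good A R' v) : Good A R v :=
  fun i α hα => hv i α (by omega)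

noncomputable def VV (A : σ → Module.End ℂ H) (s : ℕ) (v : H) : Submodule ℂ H :=
  (MvPolynomial.restrictTotalDegree σ ℂ s).map ((LinearMap.applyₗ v).comp (MM A))

lemma mem_VV {A : σ → Module.End ℂ H} {s : ℕ} {v x : H} :
    x ∈ VV A s v ↔ ∃ p : MvPolynomial σ ℂ, p.totalDegree ≤ s ∧ MM A p v = x := by
  simp [VV, Submodule.mem_map, MvPolynomial.mem_restrictTotalDegree]

lemma VV_mono {A : σ → Module.End ℂ H} {s t : ℕ} (h : s ≤ t) (v : H) : VV A s v ≤ VV A t v := by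
  intro x hx
  rw [mem_VV] at *
  obtain ⟨p, hp, h'⟩ := hx
  exact ⟨p, hp.trans h, h'⟩

lemma self_mem_VV {A : σ → Module.End ℂ H} (s : ℕ) (v : H) : v ∈ VV A s v := by
  rw [mem_VV]; exact ⟨1, by simp, by simp [MM_one]⟩

lemma VV_ortho {A : σ → Module.End ℂ H} (hA : ∀ i, (A i).IsSymmetric) {R r r' : ℕ} {v v' : H}
    (hv : Good A R v) (hr : 2 * r ≤ R) (hr' : r' ≤ r) (hv' : v' ∈ (VV A (2 * r) v)ᗮ) :
    VV A r' v' ⟂ VV A r v := by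
  rw [Submodule.isOrtho_iff_inner_eq]
  intro x hx y hy
  rw [mem_VV] at hx hy
  obtain ⟨p, hp, rfl⟩ := hx
  obtain ⟨q, hq, rfl⟩ := hy
  rw [inner_MM hA hv _ _ _ (by omega)]
  rw [Submodule.mem_orthogonal'] at hv'
  apply hv'
  rw [mem_VV]
  refine ⟨_, ?_, rfl⟩
  have := MvPolynomial.totalDegree_mul (cj p) q
  have := cj_deg p
  omega
end loc
lemma diag_exists {V X : Type} [AddCommGroup V] [Module ℂ V] [FiniteDimensional ℂ V]
    (L : X → Module.Dual ℂ V) (sep : ∀ u, (∀ z, L z u = 0) → u = 0) :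
    ∃ B : (X → ℂ) → Module.End ℂ V, (∀ c c', B c * B c' = B c' * B c) ∧
      ∀ c u w, (∀ z, L z w = c z * L z u) → B c u = w := by
  obtain ⟨κ, a, _, hspan, hli⟩ := exists_linearIndependent' ℂ L
  have : Finite κ := hli.finite
  have : Fintype κ := Fintype.ofFinite κ
  let ψ : V →ₗ[ℂ] (κ → ℂ) := LinearMap.pi fun k => L (a k)
  have hψ : ∀ u k, ψ u k = L (a k) u := fun u k => rfl
  have hinj : Function.Injective ψ := by
    rw [injective_iff_map_eq_zero]
    intro u hu
    apply sep
    intro z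
    have hz : L z ∈ Submodule.span ℂ (Set.range (L ∘ a)) := by
      rw [hspan]; exact Submodule.subset_span ⟨z, rfl⟩
    have hle : Submodule.span ℂ (Set.range (L ∘ a)) ≤ LinearMap.ker (LinearMap.applyₗ (R := ℂ) (M₂ := ℂ) u) := by
      rw [Submodule.span_le]
      rintro _ ⟨k, rfl⟩
      exact congrFun hu k
    exact hle hz
  have hcard : Module.finrank ℂ V = Module.finrank ℂ (κ → ℂ) := by
    apply le_antisymm (LinearMap.finrank_le_finrank_of_injective hinj)
    have := hli.fintype_card_le_finrank
    rw [Subspace.dual_finrank_eq] at this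
    simpa using this
  let e := LinearEquiv.ofInjectiveOfFinrankEq ψ hinj hcard
  have he : ∀ u, e u = ψ u := fun u => rfl
  let M : (X → ℂ) → Module.End ℂ (κ → ℂ) := fun c => LinearMap.pi fun k => (c (a k)) • LinearMap.proj k
  have hM : ∀ c x k, M c x k = c (a k) * x k := fun c x k => rfl
  refine ⟨fun c => e.symm.toLinearMap ∘ₗ M c ∘ₗ e.toLinearMap, ?_, ?_⟩
  · intro c c'
    ext u
    simp only [Module.End.mul_apply, LinearMap.comp_apply, LinearEquiv.coe_coe, LinearEquiv.apply_symm_apply]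
    congr 1
    ext k
    simp only [hM]; ring
  · intro c u w h
    simp only [LinearMap.comp_apply, LinearEquiv.coe_coe]
    rw [LinearEquiv.symm_apply_eq]
    ext k
    rw [hM, he, he, hψ, hψ, h]

section tile
variable {σ : Type} {H : Type} [NormedAddCommGroup H] [InnerProductSpace ℂ H]

structure Tile (A : σ → Module.End ℂ H) (V U : Submodule ℂ H) (B : σ → Module.End ℂ H) : Prop where
  le : U ≤ V
  mem : ∀ i x, B i x ∈ V
  zero : ∀ i, ∀ x ∈ Vᗮ, B i x = 0
  comm : ∀ i j, B i * B j = B j * B i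
  agree : ∀ i, ∀ u ∈ U, B i u = A i u

lemma Tile.sup {A : σ → Module.End ℂ H} {V U V' U' : Submodule ℂ H} {B B' : σ → Module.End ℂ H}
    (h : Tile A V U B) (h' : Tile A V' U' B') (ho : V ⟂ V') :
    Tile A (V ⊔ V') (U ⊔ U') (fun i => B i + B' i) := by
  have h0 : ∀ i x, x ∈ V' → B i x = 0 := fun i x hx => h.zero i x (ho.symm hx)
  have h0' : ∀ i x, x ∈ V → B' i x = 0 := fun i x hx => h'.zero i x (ho hx)
  refine ⟨sup_le_sup h.le h'.le, ?_, ?_, ?_, ?_⟩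
  · intro i x
    exact Submodule.add_mem_sup (h.mem i x) (h'.mem i x)
  · intro i x hx
    rw [← Submodule.inf_orthogonal] at hx
    rw [LinearMap.add_apply, h.zero i x hx.1, h'.zero i x hx.2, add_zero]
  · intro i j
    ext x
    have e := LinearMap.congr_fun (h.comm i j) x
    have e' := LinearMap.congr_fun (h'.comm i j) x
    simp only [Module.End.mul_apply, LinearMap.add_apply, map_add] at *
    rw [h0 i _ (h'.mem j x), h0 j _ (h'.mem i x), h0' i _ (h.mem j x), h0' j _ (h.mem i x), e, e']
  · intro i u hu
    obtain ⟨y, hy, z, hz, rfl⟩ := Submodule.mem_sup.1 hu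
    simp only [LinearMap.add_apply, map_add]
    rw [h0 i z (h'.le hz), h0' i y (h.le hy), h.agree i y hy, h'.agree i z hz]; abel

variable [FiniteDimensional ℂ H]

lemma tile_exists (σ : Type) [Finite σ] (r : ℕ) (hr : 1 ≤ r) : ∃ R : ℕ, ∀ (H : Type) [NormedAddCommGroup H]
    [InnerProductSpace ℂ H] [FiniteDimensional ℂ H]
    (A : σ → Module.End ℂ H), (∀ i, (A i).IsSymmetric) → ∀ v, Good A R v →
    ∃ B, Tile A (VV A r v) (VV A (r - 1) v) B := by
  obtain ⟨R, hR⟩ := points σ r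
  refine ⟨max R r, ?_⟩
  intro H _ _ _ A hA v hv
  have hpt := hR H A hA v (good_mono (le_max_left _ _) hv)
  let X : Type := {z : σ → ℂ // ∀ f : MvPolynomial σ ℂ, f.totalDegree ≤ r → MM A f v = 0 → MvPolynomial.eval z f = 0}
  have hsec : ∀ x : VV A r v, ∃ p : MvPolynomial σ ℂ, p.totalDegree ≤ r ∧ MM A p v = x :=
    fun x => mem_VV.1 x.2
  choose s hs1 hs2 using hsec
  have hwell : ∀ (z : X) (p q : MvPolynomial σ ℂ), p.totalDegree ≤ r → q.totalDegree ≤ r → MM A p v = MM A q v →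
      MvPolynomial.eval z.1 p = MvPolynomial.eval z.1 q := by
    intro z p q hp hq h
    rw [← sub_eq_zero, ← map_sub]
    apply z.2
    · exact (MvPolynomial.totalDegree_sub _ _).trans (max_le hp hq)
    · rw [map_sub, LinearMap.sub_apply, h, sub_self]
  let L : X → Module.Dual ℂ (VV A r v) := fun z =>
    { toFun := fun x => MvPolynomial.eval z.1 (s x)
      map_add' := by
        intro x y
        rw [← map_add]
        apply hwell z _ _ (hs1 _)
        · exact (MvPolynomial.totalDegree_add _ _).trans (max_le (hs1 _) (hs1 _))
        · rw [map_add, LinearMap.add_apply, hs2, hs2, hs2]; rfl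
      map_smul' := by
        intro c x
        rw [RingHom.id_apply, smul_eq_mul, ← MvPolynomial.smul_eval]
        apply hwell z _ _ (hs1 _)
        · exact (MvPolynomial.totalDegree_smul_le _ _).trans (hs1 _)
        · rw [map_smul, LinearMap.smul_apply, hs2, hs2]; rfl }
  have hL : ∀ z (x : VV A r v) (p : MvPolynomial σ ℂ), p.totalDegree ≤ r → MM A p v = (x : H) →
      L z x = MvPolynomial.eval z.1 p := by
    intro z x p hp h
    exact hwell z _ _ (hs1 _) hp (by rw [hs2, h])
  obtain ⟨B, hBc, hB⟩ := diag_exists L (by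
    intro u hu
    have := hpt (s u) (hs1 u) (fun z hz => hu ⟨z, hz⟩)
    rw [hs2] at this
    exact Subtype.ext this)
  let P := (VV A r v).orthogonalProjectionOnto
  refine ⟨fun i => (VV A r v).subtype ∘ₗ B (fun z => z.1 i) ∘ₗ P.toLinearMap, ?_, ?_, ?_, ?_, ?_⟩
  · exact VV_mono (by omega) v
  · intro i x
    exact Subtype.property _
  · intro i x hx
    have : P x = 0 := Submodule.orthogonalProjectionOnto_eq_zero_iff.2 hx
    simp [this]
  · intro i j
    ext x
    have e := LinearMap.congr_fun (hBc (fun z => z.1 i) (fun z => z.1 j)) (P x)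
    have hP : ∀ y : VV A r v, P y = y := fun y => Submodule.orthogonalProjectionOnto_mem_subspace_eq_self y
    simp only [Module.End.mul_apply, LinearMap.comp_apply, ContinuousLinearMap.coe_coe, Submodule.subtype_apply, hP] at *
    rw [e]
  · intro i u hu
    obtain ⟨p, hp, rfl⟩ := mem_VV.1 hu
    have hXp : MM A (MvPolynomial.X i * p) v = A i (MM A p v) := by
      apply good_X hv
      have := le_max_right R r
      omega
    have hd : (MvPolynomial.X i * p).totalDegree ≤ r := by
      have := MvPolynomial.totalDegree_mul (MvPolynomial.X i) p
      rw [MvPolynomial.totalDegree_X] at this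
      omega
    have hm : MM A p v ∈ VV A r v := VV_mono (by omega) v hu
    have hm' : A i (MM A p v) ∈ VV A r v := by rw [← hXp]; exact mem_VV.2 ⟨_, hd, rfl⟩
    have hP : P (MM A p v) = ⟨MM A p v, hm⟩ := Submodule.orthogonalProjectionOnto_mem_subspace_eq_self (⟨MM A p v, hm⟩ : VV A r v)
    simp only [LinearMap.comp_apply, ContinuousLinearMap.coe_coe, hP, Submodule.subtype_apply]
    rw [hB (fun z => z.1 i) ⟨MM A p v, hm⟩ ⟨A i (MM A p v), hm'⟩]
    intro z
    rw [hL z _ (MvPolynomial.X i * p) hd hXp, hL z _ p (by omega) rfl]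
    simp

set_option linter.unusedSectionVars false in
lemma VV_finrank [Fintype σ] (A : σ → Module.End ℂ H) (s : ℕ) (v : H) :
    Module.finrank ℂ (VV A s v) ≤ (s + 1) ^ (Fintype.card σ) := by
  classical
  refine (Submodule.finrank_map_le _ _).trans ?_
  have b := MvPolynomial.basisRestrictSupport ℂ {n : σ →₀ ℕ | n.degree ≤ s}
  have : Finite {n : σ →₀ ℕ | n.degree ≤ s} := Finsupp.finite_of_degree_le s
  have h := Module.finrank_eq_nat_card_basis b
  have h2 : Module.finrank ℂ (MvPolynomial.restrictTotalDegree σ ℂ s) = Nat.card {n : σ →₀ ℕ | n.degree ≤ s} := h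
  rw [h2]
  let g : {n : σ →₀ ℕ | n.degree ≤ s} → (σ → Fin (s + 1)) := fun n i =>
    ⟨n.1 i, Nat.lt_succ_of_le ((Finsupp.le_degree i n.1).trans n.2)⟩
  have hg : Function.Injective g := by
    intro n m h
    apply Subtype.ext
    ext i
    have := congrFun h i
    simpa [g] using this
  have := Nat.card_le_card_of_injective g hg
  simpa using this

lemma pigeon (n : ℕ) (η : ℝ) (hη : 0 < η) : ∃ R0 : ℕ, ∀ f : ℕ → ℕ, Monotone f → 1 ≤ f 0 →
    (∀ s, f s ≤ (s + 1) ^ n) → ∃ r, 1 ≤ r ∧ r ≤ R0 ∧ f (2 * r) ≤ 4 ^ (n + 1) * f r ∧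
      (f r : ℝ) ≤ (1 + η) * f (r - 1) := by
  obtain ⟨s0, hs0⟩ := pow_unbounded_of_one_lt ((4 : ℝ) ^ (n + 1)) (by linarith : 1 < 1 + η)
  have hs0pos : 1 ≤ s0 := by
    by_contra h
    have : s0 = 0 := by omega
    subst this
    have : (1:ℝ) ≤ 4 ^ (n+1) := one_le_pow₀ (by norm_num)
    simp at hs0; linarith
  obtain ⟨J, hJ⟩ := pow_unbounded_of_one_lt ((2 * s0) ^ n) (by norm_num : 1 < 4)
  refine ⟨2 * (4 ^ J * s0), ?_⟩
  intro f hf h0 hpoly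
  have hpos : ∀ s, 1 ≤ f s := fun s => h0.trans (hf (Nat.zero_le s))
  have h1 : ∃ j < J, f (4 * (4 ^ j * s0)) ≤ 4 ^ (n + 1) * f (4 ^ j * s0) := by
    by_contra hcon
    push Not at hcon
    have hind : ∀ j ≤ J, (4 ^ (n + 1)) ^ j ≤ f (4 ^ j * s0) := by
      intro j
      induction j with
      | zero => intro _; simpa using hpos _
      | succ j ih =>
        intro hj
        have e1 := ih (by omega)
        have e2 := hcon j (by omega)
        have e3 : 4 ^ (j + 1) * s0 = 4 * (4 ^ j * s0) := by ring
        rw [e3, pow_succ]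
        have e4 := Nat.mul_le_mul_left (4 ^ (n + 1)) e1
        rw [mul_comm]; omega
    have e1 := hind J le_rfl
    have e2 := hpoly (4 ^ J * s0)
    have e3 : (4 ^ J * s0 + 1) ^ n ≤ (4 ^ J * (2 * s0)) ^ n := by
      apply Nat.pow_le_pow_left
      have : 1 ≤ 4 ^ J * s0 := Nat.mul_pos (by positivity) hs0pos
      nlinarith
    have e4 : (4 ^ J * (2 * s0)) ^ n < (4 ^ J) ^ n * 4 ^ J := by
      rw [mul_pow]; exact Nat.mul_lt_mul_of_pos_left hJ (by positivity)
    have e5 : (4 ^ (n + 1)) ^ J = (4 ^ J) ^ n * 4 ^ J := by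
      rw [← pow_mul, ← pow_mul, ← pow_add]; ring_nf
    omega
  obtain ⟨j, hj, hdoub⟩ := h1
  set s := 4 ^ j * s0 with hs
  have hss0 : s0 ≤ s := Nat.le_mul_of_pos_left _ (by positivity)
  have hsJ : s ≤ 4 ^ J * s0 := Nat.mul_le_mul_right _ (Nat.pow_le_pow_right (by norm_num) hj.le)
  have h2 : ∃ r, s < r ∧ r ≤ 2 * s ∧ (f r : ℝ) ≤ (1 + η) * f (r - 1) := by
    by_contra hcon
    push Not at hcon
    have hind : ∀ t ≤ s, (1 + η) ^ t * f s ≤ (f (s + t) : ℝ) := by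
      intro t
      induction t with
      | zero => intro _; simp
      | succ t ih =>
        intro ht
        have e1 := ih (by omega)
        have e2 := hcon (s + (t + 1)) (by omega) (by omega)
        have e3 : s + (t + 1) - 1 = s + t := by omega
        rw [e3] at e2
        rw [pow_succ]
        nlinarith
    have e1 := hind s le_rfl
    have e2 : (1 + η) ^ s0 ≤ (1 + η) ^ s := pow_le_pow_right₀ (by linarith) hss0
    have e3 : (f (s + s) : ℝ) ≤ f (4 * s) := by exact_mod_cast hf (by omega)
    have e4 : (f (4 * s) : ℝ) ≤ 4 ^ (n + 1) * f s := by exact_mod_cast hdoub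
    have e5 : (1 : ℝ) ≤ f s := by exact_mod_cast hpos s
    nlinarith
  obtain ⟨r, hr1, hr2, hr3⟩ := h2
  refine ⟨r, by omega, by omega, ?_, hr3⟩
  calc f (2 * r) ≤ f (4 * s) := hf (by omega)
    _ ≤ 4 ^ (n + 1) * f s := hdoub
    _ ≤ 4 ^ (n + 1) * f r := Nat.mul_le_mul_left _ (hf hr1.le)

lemma greedy [Fintype σ] (A : σ → Module.End ℂ H) (hA : ∀ i, (A i).IsSymmetric) (η : ℝ) (K R R0 : ℕ)
    (hR : 2 * R0 ≤ R) (rad : H → ℕ) (hrad : ∀ v, rad v ≤ R0)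
    (h1 : ∀ v, v ≠ 0 → Good A R v → Module.finrank ℂ (VV A (2 * rad v) v) ≤ K * Module.finrank ℂ (VV A (rad v) v))
    (h2 : ∀ v, v ≠ 0 → Good A R v → ∃ U B, Tile A (VV A (rad v) v) U B ∧
      (Module.finrank ℂ (VV A (rad v) v) : ℝ) ≤ (1 + η) * Module.finrank ℂ U) :
    ∀ (N : ℕ) (W : Submodule ℂ H), Module.finrank ℂ W ≤ N → (∀ v ∈ W, Good A R v) →
      ∃ V U B, Tile A V U B ∧ (Module.finrank ℂ V : ℝ) ≤ (1 + η) * Module.finrank ℂ U ∧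
        Module.finrank ℂ W ≤ K * Module.finrank ℂ V ∧ V ≤ ⨆ v ∈ W, VV A (rad v) v := by
  intro N
  have triv : ∀ W : Submodule ℂ H, W = ⊥ → ∃ V U B, Tile A V U B ∧ (Module.finrank ℂ V : ℝ) ≤ (1 + η) * Module.finrank ℂ U ∧
        Module.finrank ℂ W ≤ K * Module.finrank ℂ V ∧ V ≤ ⨆ v ∈ W, VV A (rad v) v := by
    rintro W rfl
    refine ⟨⊥, ⊥, fun _ => 0, ⟨le_rfl, by simp, by simp, by simp, ?_⟩, by simp, by simp, bot_le⟩
    intro i u hu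
    rw [Submodule.mem_bot] at hu
    simp [hu]
  induction N with
  | zero =>
    intro W hW _
    exact triv W (Submodule.finrank_eq_zero.1 (by omega))
  | succ N ih =>
    intro W hW hgood
    by_cases hbot : W = ⊥
    · exact triv W hbot
    obtain ⟨v0, hv0, hv0'⟩ := W.ne_bot_iff.1 hbot
    have hmax : ∃ v ∈ W, v ≠ 0 ∧ ∀ v' ∈ W, v' ≠ 0 → rad v' ≤ rad v := by
      let S : Set ℕ := rad '' {v | v ∈ W ∧ v ≠ 0}
      have hne : S.Nonempty := ⟨_, v0, ⟨hv0, hv0'⟩, rfl⟩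
      have hbd : BddAbove S := ⟨R0, by rintro _ ⟨v, _, rfl⟩; exact hrad v⟩
      obtain ⟨v, ⟨hv, hv'⟩, hvS⟩ := Nat.sSup_mem hne hbd
      refine ⟨v, hv, hv', fun v' hw hw' => ?_⟩
      rw [hvS]
      exact le_csSup hbd ⟨v', ⟨hw, hw'⟩, rfl⟩
    obtain ⟨v, hv, hvne, hvmax⟩ := hmax
    have hg := hgood v hv
    set W' := W ⊓ (VV A (2 * rad v) v)ᗮ with hW'
    have hlt : W' < W := by
      refine lt_of_le_of_ne inf_le_left fun h => ?_
      have : v ∈ W' := by rw [h]; exact hv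
      have h3 := this.2
      have h4 := (Submodule.mem_orthogonal _ _).1 h3 v (self_mem_VV _ _)
      exact hvne (inner_self_eq_zero.1 h4)
    have hfl := Submodule.finrank_lt_finrank_of_lt hlt
    obtain ⟨V, U, B, hT, hη, hd, hle⟩ := ih W' (by omega) (fun x hx => hgood x hx.1)
    obtain ⟨U0, B0, hT0, hη0⟩ := h2 v hvne hg
    have hortho : V ⟂ VV A (rad v) v := by
      refine Submodule.IsOrtho.mono_left hle ?_
      rw [Submodule.isOrtho_iSup_left]
      intro x
      rw [Submodule.isOrtho_iSup_left]
      intro hx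
      by_cases hx0 : x = 0
      · subst hx0
        rw [Submodule.isOrtho_iff_inner_eq]
        intro a ha b _
        obtain ⟨p, _, rfl⟩ := mem_VV.1 ha
        simp
      · exact VV_ortho hA hg (by have := hrad v; omega) (hvmax x hx.1 hx0) hx.2
    refine ⟨V ⊔ VV A (rad v) v, U ⊔ U0, _, hT.sup hT0 hortho, ?_, ?_, ?_⟩
    · have e1 := Submodule.finrank_sup_add_finrank_inf_eq V (VV A (rad v) v)
      have e2 := Submodule.finrank_sup_add_finrank_inf_eq U U0
      rw [hortho.disjoint.eq_bot, finrank_bot] at e1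
      rw [(hortho.disjoint.mono hT.le hT0.le).eq_bot, finrank_bot] at e2
      have e1' : (Module.finrank ℂ ↥(V ⊔ VV A (rad v) v) : ℝ) = Module.finrank ℂ V + Module.finrank ℂ (VV A (rad v) v) := by exact_mod_cast e1
      have e2' : (Module.finrank ℂ ↥(U ⊔ U0) : ℝ) = Module.finrank ℂ U + Module.finrank ℂ U0 := by exact_mod_cast e2
      rw [e1', e2']; linarith
    · have e1 := Submodule.finrank_sup_add_finrank_inf_eq V (VV A (rad v) v)
      rw [hortho.disjoint.eq_bot, finrank_bot] at e1
      have e3 := Submodule.finrank_sup_add_finrank_inf_eq W (VV A (2 * rad v) v)ᗮ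
      have e4 := Submodule.finrank_add_finrank_orthogonal (VV A (2 * rad v) v)
      have e5 := Submodule.finrank_le (W ⊔ (VV A (2 * rad v) v)ᗮ)
      rw [← hW'] at e3
      have e6 := h1 v hvne hg
      have e7 : K * Module.finrank ℂ ↥(V ⊔ VV A (rad v) v) = K * Module.finrank ℂ V + K * Module.finrank ℂ (VV A (rad v) v) := by
        rw [← mul_add]; congr 1
      omega
    · refine sup_le (hle.trans ?_) ?_
      · exact biSup_mono fun x hx => hx.1
      · exact le_iSup₂_of_le v hv le_rfl
end tile
set_option linter.unusedSectionVars false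
section rk
variable {E F G : Type} [AddCommGroup E] [Module ℂ E] [AddCommGroup F] [Module ℂ F] [AddCommGroup G] [Module ℂ G]
  [FiniteDimensional ℂ E] [FiniteDimensional ℂ F] [FiniteDimensional ℂ G]

noncomputable def rk (T : E →ₗ[ℂ] F) : ℕ := Module.finrank ℂ (LinearMap.range T)

lemma rk_add (T S : E →ₗ[ℂ] F) : rk (T + S) ≤ rk T + rk S := by
  have h : LinearMap.range (T + S) ≤ LinearMap.range T ⊔ LinearMap.range S := by
    rintro _ ⟨x, rfl⟩
    exact Submodule.add_mem_sup ⟨x, rfl⟩ ⟨x, rfl⟩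
  exact (Submodule.finrank_mono h).trans (Submodule.finrank_add_le_finrank_add_finrank _ _)

lemma rk_neg (T : E →ₗ[ℂ] F) : rk (-T) = rk T := by
  unfold rk; rw [LinearMap.range_neg]

lemma rk_sub (T S : E →ₗ[ℂ] F) : rk (T - S) ≤ rk T + rk S := by
  rw [sub_eq_add_neg, ← rk_neg S]; exact rk_add _ _

lemma rk_comp_left (T : E →ₗ[ℂ] F) (S : F →ₗ[ℂ] G) : rk (S ∘ₗ T) ≤ rk T := by
  unfold rk; rw [LinearMap.range_comp]; exact Submodule.finrank_map_le _ _

lemma rk_comp_right (T : E →ₗ[ℂ] F) (S : F →ₗ[ℂ] G) : rk (S ∘ₗ T) ≤ rk S :=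
  Submodule.finrank_mono (LinearMap.range_comp_le_range _ _)

lemma rk_smul (c : ℂ) (T : E →ₗ[ℂ] F) : rk (c • T) ≤ rk T := by
  apply Submodule.finrank_mono
  rintro _ ⟨x, rfl⟩
  exact ⟨c • x, by simp⟩

lemma rk_le (T : E →ₗ[ℂ] F) : rk T ≤ Module.finrank ℂ E := LinearMap.finrank_range_le T

lemma codim_inf {ι : Type} (s : Finset ι) (T : ι → Module.End ℂ E) :
    Module.finrank ℂ E ≤ Module.finrank ℂ ↥(⨅ i ∈ s, LinearMap.ker (T i)) + ∑ i ∈ s, rk (T i) := by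
  classical
  induction s using Finset.induction_on with
  | empty =>
    have : (⨅ i ∈ (∅ : Finset ι), LinearMap.ker (T i)) = ⊤ := by simp
    rw [this, finrank_top]; simp
  | insert a s ha ih =>
    rw [Finset.iInf_insert, Finset.sum_insert ha]
    have e1 := Submodule.finrank_sup_add_finrank_inf_eq (LinearMap.ker (T a)) (⨅ i ∈ s, LinearMap.ker (T i))
    have e2 := Submodule.finrank_le (LinearMap.ker (T a) ⊔ (⨅ i ∈ s, LinearMap.ker (T i)))
    have e3 := LinearMap.finrank_range_add_finrank_ker (T a)
    unfold rk at *
    omega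
end rk

lemma perm_rank {σ : Type} {l l' : List σ} (h : l.Perm l') : ∃ C : ℕ, ∀ (H : Type) [NormedAddCommGroup H]
    [InnerProductSpace ℂ H] [FiniteDimensional ℂ H] (A : σ → Module.End ℂ H) (k : ℕ),
    (∀ i j, rk (A i * A j - A j * A i) ≤ k) → rk (wd A l - wd A l') ≤ C * k := by
  induction h with
  | nil => exact ⟨0, by intro H _ _ _ A k _; rw [sub_self]; simp [rk, LinearMap.range_zero]⟩
  | cons x _ ih =>
    obtain ⟨C, hC⟩ := ih
    refine ⟨C, ?_⟩
    intro H _ _ _ A k hk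
    refine le_trans ?_ (hC H A k hk)
    simp only [wd, List.map_cons, List.prod_cons]
    rw [← mul_sub]
    exact rk_comp_left _ _
  | swap x y l =>
    refine ⟨1, ?_⟩
    intro H _ _ _ A k hk
    rw [one_mul]
    refine le_trans ?_ (hk y x)
    simp only [wd, List.map_cons, List.prod_cons]
    rw [← mul_assoc, ← mul_assoc, ← sub_mul]
    exact rk_comp_right _ _
  | trans _ _ ih1 ih2 =>
    obtain ⟨C1, h1⟩ := ih1
    obtain ⟨C2, h2⟩ := ih2
    refine ⟨C1 + C2, ?_⟩
    intro H _ _ _ A k hk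
    rw [← sub_add_sub_cancel, add_mul]
    exact (rk_add _ _).trans (add_le_add (h1 H A k hk) (h2 H A k hk))

lemma good_sub (σ : Type) [Fintype σ] (R : ℕ) : ∃ C : ℕ, ∀ (H : Type) [NormedAddCommGroup H]
    [InnerProductSpace ℂ H] [FiniteDimensional ℂ H] (A : σ → Module.End ℂ H) (k : ℕ),
    (∀ i j, rk (A i * A j - A j * A i) ≤ k) →
    ∃ W : Submodule ℂ H, (∀ v ∈ W, Good A R v) ∧ Module.finrank ℂ H ≤ Module.finrank ℂ W + C * k := by
  classical
  have hfin : {α : σ →₀ ℕ | α.degree ≤ R}.Finite := Finsupp.finite_of_degree_le R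
  have hperm : ∀ x : σ × (σ →₀ ℕ), ((Finsupp.toMultiset (Finsupp.single x.1 1 + x.2)).toList).Perm
      (x.1 :: (Finsupp.toMultiset x.2).toList) := by
    intro x
    rw [← Multiset.coe_eq_coe, Multiset.coe_toList, ← Multiset.cons_coe, Multiset.coe_toList, map_add,
      Finsupp.toMultiset_single, one_smul, Multiset.singleton_add]
  choose C hC using fun x => perm_rank (hperm x)
  refine ⟨∑ x ∈ (Finset.univ ×ˢ hfin.toFinset), C x, ?_⟩
  intro H _ _ _ A k hk
  let T : σ × (σ →₀ ℕ) → Module.End ℂ H := fun x =>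
    wd A (Finsupp.toMultiset (Finsupp.single x.1 1 + x.2)).toList - wd A (x.1 :: (Finsupp.toMultiset x.2).toList)
  refine ⟨⨅ x ∈ (Finset.univ ×ˢ hfin.toFinset), LinearMap.ker (T x), ?_, ?_⟩
  · intro v hv i α hα
    simp only [Submodule.mem_iInf] at hv
    have h := hv (i, α) (by simp [hα.le])
    simp only [T, LinearMap.mem_ker, LinearMap.sub_apply, sub_eq_zero] at h
    have e : (MvPolynomial.X i * MvPolynomial.monomial α 1 : MvPolynomial σ ℂ) =
        MvPolynomial.monomial (Finsupp.single i 1 + α) 1 := by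
      rw [MvPolynomial.X, MvPolynomial.monomial_mul, one_mul]
    rw [e, MM_monomial, MM_monomial, one_smul, one_smul, h]
    simp [wd]
  · refine (codim_inf (Finset.univ ×ˢ hfin.toFinset) T).trans ?_
    rw [Finset.sum_mul]
    gcongr with x hx
    exact hC x H A k hk

lemma step (σ : Type) [Fintype σ] (η : ℝ) (hη : 0 < η) : ∃ δ : ℝ, 0 < δ ∧ ∀ (H : Type) [NormedAddCommGroup H]
    [InnerProductSpace ℂ H] [FiniteDimensional ℂ H] (A : σ → Module.End ℂ H), (∀ i, (A i).IsSymmetric) →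
    (∀ i j, (rk (A i * A j - A j * A i) : ℝ) ≤ δ * Module.finrank ℂ H) →
    ∃ V U B, Tile A V U B ∧ (Module.finrank ℂ V : ℝ) ≤ (1 + η) * Module.finrank ℂ U ∧
      (Module.finrank ℂ H : ℝ) ≤ 2 * 4 ^ (Fintype.card σ + 1) * Module.finrank ℂ V := by
  classical
  obtain ⟨R0, hR0⟩ := pigeon (Fintype.card σ) η hη
  have ht : ∀ r : ℕ, ∃ R : ℕ, 1 ≤ r → ∀ (H : Type) [NormedAddCommGroup H]
    [InnerProductSpace ℂ H] [FiniteDimensional ℂ H]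
    (A : σ → Module.End ℂ H), (∀ i, (A i).IsSymmetric) → ∀ v, Good A R v →
    ∃ B, Tile A (VV A r v) (VV A (r - 1) v) B := by
    intro r
    by_cases h : 1 ≤ r
    · obtain ⟨R, hR⟩ := tile_exists σ r h
      exact ⟨R, fun _ => hR⟩
    · exact ⟨0, fun h' => absurd h' h⟩
  choose Rt hRt using ht
  let R := 2 * R0 + ∑ r ∈ Finset.range (R0 + 1), Rt r
  obtain ⟨C, hC⟩ := good_sub σ R
  refine ⟨1 / (2 * (C + 1)), by positivity, ?_⟩
  intro H _ _ _ A hA hcomm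
  obtain ⟨W, hWg, hWd⟩ := hC H A ⌊(1 / (2 * (C + 1)) : ℝ) * Module.finrank ℂ H⌋₊
    (fun i j => Nat.le_floor (hcomm i j))
  have hex : ∀ v : H, ∃ r, r ≤ R0 ∧ (v ≠ 0 → 1 ≤ r ∧
      Module.finrank ℂ (VV A (2 * r) v) ≤ 4 ^ (Fintype.card σ + 1) * Module.finrank ℂ (VV A r v) ∧
      (Module.finrank ℂ (VV A r v) : ℝ) ≤ (1 + η) * Module.finrank ℂ (VV A (r - 1) v)) := by
    intro v
    by_cases hv : v = 0
    · exact ⟨0, by omega, fun h => absurd hv h⟩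
    · obtain ⟨r, h1, h2, h3, h4⟩ := hR0 (fun s => Module.finrank ℂ (VV A s v))
        (fun s t hst => Submodule.finrank_mono (VV_mono hst v))
        (by
          rw [Nat.one_le_iff_ne_zero]
          intro h
          have := Submodule.finrank_eq_zero.1 h
          have h' := self_mem_VV (A := A) 0 v
          rw [this] at h'
          exact hv (by simpa using h'))
        (fun s => VV_finrank A s v)
      exact ⟨r, h2, fun _ => ⟨h1, h3, h4⟩⟩
  choose rad hrad hrad' using hex
  obtain ⟨V, U, B, hT, hVU, hWV, _⟩ := greedy A hA η (4 ^ (Fintype.card σ + 1)) R R0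
    (by simp only [R]; omega) rad hrad (fun v hv _ => (hrad' v hv).2.1)
    (fun v hv hg => by
      obtain ⟨B, hB⟩ := hRt (rad v) (hrad' v hv).1 H A hA v (good_mono (by
        have : Rt (rad v) ≤ ∑ r ∈ Finset.range (R0 + 1), Rt r :=
          Finset.single_le_sum (f := Rt) (fun _ _ => Nat.zero_le _) (Finset.mem_range.2 (by have := hrad v; omega))
        simp only [R]; omega) hg)
      exact ⟨_, B, hB, (hrad' v hv).2.2⟩)
    _ W le_rfl hWg
  refine ⟨V, U, B, hT, hVU, ?_⟩
  have e1 : (⌊(1 / (2 * (C + 1)) : ℝ) * Module.finrank ℂ H⌋₊ : ℝ) ≤ (1 / (2 * (C + 1)) : ℝ) * Module.finrank ℂ H :=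
    Nat.floor_le (by positivity)
  have e2 : (Module.finrank ℂ H : ℝ) ≤ Module.finrank ℂ W + C * (⌊(1 / (2 * (C + 1)) : ℝ) * Module.finrank ℂ H⌋₊ : ℝ) := by
    exact_mod_cast hWd
  have e3 : (Module.finrank ℂ W : ℝ) ≤ 4 ^ (Fintype.card σ + 1) * Module.finrank ℂ V := by exact_mod_cast hWV
  have e4 : C * ((1 / (2 * (C + 1)) : ℝ) * Module.finrank ℂ H) ≤ (Module.finrank ℂ H : ℝ) / 2 := by
    have : (C : ℝ) * (1 / (2 * (C + 1))) ≤ 1 / 2 := by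
      rw [mul_one_div, div_le_iff₀ (by positivity)]; linarith
    calc _ = (C : ℝ) * (1 / (2 * (C + 1))) * Module.finrank ℂ H := by ring
      _ ≤ 1 / 2 * Module.finrank ℂ H := by gcongr
      _ = _ := by ring
  have e5 : C * (⌊(1 / (2 * (C + 1)) : ℝ) * Module.finrank ℂ H⌋₊ : ℝ) ≤ C * ((1 / (2 * (C + 1)) : ℝ) * Module.finrank ℂ H) := by
    gcongr
  linarith
lemma compress {σ : Type} {H : Type} [NormedAddCommGroup H] [InnerProductSpace ℂ H] [FiniteDimensional ℂ H]
    {A B : σ → Module.End ℂ H} {V U : Submodule ℂ H} (hA : ∀ i, (A i).IsSymmetric) (hT : Tile A V U B) (m : ℕ)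
    (hm : Module.finrank ℂ V = Module.finrank ℂ U + m) :
    ∃ A' : σ → Module.End ℂ Vᗮ, (∀ i, (A' i).IsSymmetric) ∧
      (∀ i j, rk (A' i * A' j - A' j * A' i) ≤ rk (A i * A j - A j * A i) + 2 * m) ∧
      ∀ B' : σ → Module.End ℂ Vᗮ, (∀ i j, B' i * B' j = B' j * B' i) →
        ∃ C : σ → Module.End ℂ H, (∀ i j, C i * C j = C j * C i) ∧
          ∀ i, rk (A i - C i) ≤ 2 * m + rk (A' i - B' i) := by
  let Q : H →ₗ[ℂ] Vᗮ := Vᗮ.orthogonalProjectionOnto.toLinearMap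
  let ι : Vᗮ →ₗ[ℂ] H := Vᗮ.subtype
  have hQι : ∀ y : Vᗮ, Q (ι y) = y := fun y => Submodule.orthogonalProjectionOnto_mem_subspace_eq_self y
  have hQV : ∀ x ∈ V, Q x = 0 := by
    intro x hx
    apply Submodule.orthogonalProjectionOnto_eq_zero_iff.2
    rwa [Submodule.orthogonal_orthogonal]
  have hιm : ∀ y : Vᗮ, ι y ∈ Vᗮ := fun y => y.2
  have hpV : ∀ x, x - ι (Q x) ∈ V := by
    intro x
    have : x - ι (Q x) ∈ Vᗮᗮ := Submodule.sub_starProjection_mem_orthogonal x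
    rwa [Submodule.orthogonal_orthogonal] at this
  let q : Module.End ℂ H := ι ∘ₗ Q
  let p : Module.End ℂ H := 1 - q
  have hpx : ∀ x, p x = x - ι (Q x) := fun x => rfl
  have r1 : ∀ i, rk (p * A i * q) ≤ m := by
    intro i
    have hsub : LinearMap.range (p * A i * q) ≤ V ⊓ Uᗮ := by
      rintro _ ⟨x, rfl⟩
      refine ⟨hpV _, ?_⟩
      rw [SetLike.mem_coe, Submodule.mem_orthogonal]
      intro u hu
      change inner ℂ u (A i (ι (Q x)) - ι (Q (A i (ι (Q x))))) = 0
      rw [inner_sub_right]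
      have huV := hT.le hu
      rw [Submodule.inner_right_of_mem_orthogonal huV (hιm _), ← hA i, ← hT.agree i u hu,
        Submodule.inner_right_of_mem_orthogonal (hT.mem i u) (hιm _)]
      simp
    refine (Submodule.finrank_mono hsub).trans ?_
    have := Submodule.finrank_add_inf_finrank_orthogonal hT.le
    rw [inf_comm] at this
    omega
  have r2 : ∀ i, rk ((A i - B i) * p) ≤ m := by
    intro i
    have hker : U ⊔ Vᗮ ≤ LinearMap.ker ((A i - B i) * p) := by
      apply sup_le
      · intro u hu
        rw [LinearMap.mem_ker]
        change (A i - B i) (u - ι (Q u)) = 0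
        rw [hQV u (hT.le hu), map_zero, sub_zero, LinearMap.sub_apply, hT.agree i u hu, sub_self]
      · intro x hx
        rw [LinearMap.mem_ker]
        change (A i - B i) (x - ι (Q x)) = 0
        have : ι (Q x) = x := by
          have := hQι ⟨x, hx⟩
          exact congrArg ι this
        rw [this, sub_self, map_zero]
    have h1 := Submodule.finrank_mono hker
    have h2 := LinearMap.finrank_range_add_finrank_ker ((A i - B i) * p)
    have h3 := Submodule.finrank_sup_add_finrank_inf_eq U Vᗮ
    have h4 := Submodule.finrank_add_finrank_orthogonal V
    have h5 : U ⊓ Vᗮ = ⊥ := by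
      rw [eq_bot_iff, ← Submodule.inf_orthogonal_eq_bot V]
      exact inf_le_inf_right _ hT.le
    rw [h5, finrank_bot] at h3
    unfold rk
    omega
  refine ⟨fun i => Q ∘ₗ A i ∘ₗ ι, ?_, ?_, ?_⟩
  · intro i x y
    change inner ℂ (Vᗮ.orthogonalProjectionOnto (A i x)) y = inner ℂ x (Vᗮ.orthogonalProjectionOnto (A i y))
    rw [Submodule.inner_orthogonalProjectionOnto_eq_of_mem_right, Submodule.inner_orthogonalProjectionOnto_eq_of_mem_left]
    exact hA i _ _
  · intro i j
    have e : (Q ∘ₗ A i ∘ₗ ι) * (Q ∘ₗ A j ∘ₗ ι) - (Q ∘ₗ A j ∘ₗ ι) * (Q ∘ₗ A i ∘ₗ ι)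
        = Q ∘ₗ (A i * A j - A j * A i) ∘ₗ ι - (Q ∘ₗ A i) ∘ₗ (p * A j * q) ∘ₗ ι
          + (Q ∘ₗ A j) ∘ₗ (p * A i * q) ∘ₗ ι := by
      ext1 y
      change Q (A i (ι (Q (A j (ι y))))) - Q (A j (ι (Q (A i (ι y))))) =
        Q (A i (A j (ι y)) - A j (A i (ι y))) - Q (A i (A j (ι (Q (ι y))) - ι (Q (A j (ι (Q (ι y)))))))
         + Q (A j (A i (ι (Q (ι y))) - ι (Q (A i (ι (Q (ι y)))))))
      rw [hQι]
      simp only [map_sub]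
      abel
    rw [e]
    refine (rk_add _ _).trans ?_
    have a1 := rk_sub (Q ∘ₗ (A i * A j - A j * A i) ∘ₗ ι) ((Q ∘ₗ A i) ∘ₗ (p * A j * q) ∘ₗ ι)
    have a2 : rk (Q ∘ₗ (A i * A j - A j * A i) ∘ₗ ι) ≤ _ := (rk_comp_left _ _).trans (rk_comp_right _ _)
    have a3 : rk ((Q ∘ₗ A i) ∘ₗ (p * A j * q) ∘ₗ ι) ≤ _ := (rk_comp_left _ _).trans (rk_comp_right _ _)
    have a4 : rk ((Q ∘ₗ A j) ∘ₗ (p * A i * q) ∘ₗ ι) ≤ _ := (rk_comp_left _ _).trans (rk_comp_right _ _)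
    have := r1 i
    have := r1 j
    omega
  · intro B' hB'
    refine ⟨fun i => B i + ι ∘ₗ B' i ∘ₗ Q, ?_, ?_⟩
    · intro i j
      ext1 x
      change B i (B j x + ι (B' j (Q x))) + ι (B' i (Q (B j x + ι (B' j (Q x))))) =
        B j (B i x + ι (B' i (Q x))) + ι (B' j (Q (B i x + ι (B' i (Q x)))))
      simp only [map_add, hQι, hQV _ (hT.mem _ _), hT.zero _ _ (hιm _), add_zero, zero_add]
      have h1 : B i (B j x) = B j (B i x) := LinearMap.congr_fun (hT.comm i j) x
      have h2 : B' i (B' j (Q x)) = B' j (B' i (Q x)) := LinearMap.congr_fun (hB' i j) (Q x)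
      rw [h1, h2]
    · intro i
      have e : A i - (B i + ι ∘ₗ B' i ∘ₗ Q) = (A i - B i) * p + p * A i * q
          + ι ∘ₗ (Q ∘ₗ A i ∘ₗ ι - B' i) ∘ₗ Q := by
        ext1 x
        change A i x - (B i x + ι (B' i (Q x))) = (A i (x - ι (Q x)) - B i (x - ι (Q x)))
          + (A i (ι (Q x)) - ι (Q (A i (ι (Q x))))) + ι (Q (A i (ι (Q x))) - B' i (Q x))
        simp only [map_sub, hT.zero _ _ (hιm _)]
        abel
      rw [e]
      have a1 := rk_add ((A i - B i) * p + p * A i * q) (ι ∘ₗ (Q ∘ₗ A i ∘ₗ ι - B' i) ∘ₗ Q)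
      have a2 := rk_add ((A i - B i) * p) (p * A i * q)
      have a3 : rk (ι ∘ₗ (Q ∘ₗ A i ∘ₗ ι - B' i) ∘ₗ Q) ≤ _ := (rk_comp_left _ _).trans (rk_comp_right _ _)
      have := r1 i
      have := r2 i
      change _ ≤ 2 * m + rk (Q ∘ₗ A i ∘ₗ ι - B' i)
      omega

def PP (σ : Type) [Fintype σ] (ε : ℝ) : Prop := ∃ δ : ℝ, 0 < δ ∧ ∀ (H : Type) [NormedAddCommGroup H]
  [InnerProductSpace ℂ H] [FiniteDimensional ℂ H] (A : σ → Module.End ℂ H), (∀ i, (A i).IsSymmetric) →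
  (∀ i j, (rk (A i * A j - A j * A i) : ℝ) ≤ δ * Module.finrank ℂ H) →
  ∃ B : σ → Module.End ℂ H, (∀ i j, B i * B j = B j * B i) ∧ ∀ i, (rk (A i - B i) : ℝ) ≤ ε * Module.finrank ℂ H

lemma PP_one (σ : Type) [Fintype σ] : PP σ 1 := by
  refine ⟨1, one_pos, fun H _ _ _ A _ _ => ⟨0, fun i j => rfl, fun i => ?_⟩⟩
  rw [one_mul]; exact_mod_cast rk_le _

lemma PP_mono {σ : Type} [Fintype σ] {ε ε' : ℝ} (h : ε ≤ ε') (hP : PP σ ε) : PP σ ε' := by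
  obtain ⟨δ, hδ, hP⟩ := hP
  refine ⟨δ, hδ, fun H _ _ _ A hA hc => ?_⟩
  obtain ⟨B, hB, hr⟩ := hP H A hA hc
  exact ⟨B, hB, fun i => (hr i).trans (mul_le_mul_of_nonneg_right h (Nat.cast_nonneg _))⟩

lemma PP_step {σ : Type} [Fintype σ] {ε : ℝ} (hε : 0 < ε) (hP : PP σ ε) :
    PP σ ((1 - 1 / (2 * 4 ^ (Fintype.card σ + 1)) / 2) * ε) := by
  obtain ⟨δ', hδ', hP⟩ := hP
  have hK1 : (1 : ℝ) ≤ 2 * 4 ^ (Fintype.card σ + 1) := by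
    have : (1:ℝ) ≤ 4 ^ (Fintype.card σ + 1) := one_le_pow₀ (by norm_num)
    linarith
  obtain ⟨c, hc, hcK⟩ : ∃ c : ℝ, c = 1 / (2 * 4 ^ (Fintype.card σ + 1)) ∧ c * (2 * 4 ^ (Fintype.card σ + 1)) = 1 :=
    ⟨_, rfl, by field_simp⟩
  rw [← hc]
  have hc0 : 0 < c := by rw [hc]; positivity
  have hc1 : c ≤ 1 := by rw [hc]; exact (div_le_one (by linarith)).2 hK1
  obtain ⟨γ, hγ⟩ : ∃ γ, γ = c * ε / 4 := ⟨_, rfl⟩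
  have hγ0 : 0 < γ := by rw [hγ]; positivity
  obtain ⟨η, hη0, hη1, hη2⟩ : ∃ η : ℝ, 0 < η ∧ η ≤ c * ε / 8 ∧ η ≤ δ' * γ / 4 :=
    ⟨min (c * ε / 8) (δ' * γ / 4), by positivity, min_le_left _ _, min_le_right _ _⟩
  obtain ⟨δ₀, hδ₀, hS⟩ := step σ η hη0
  refine ⟨min δ₀ (δ' * γ / 2), by positivity, ?_⟩
  intro H _ _ _ A hA hcom
  have hd0 : (0 : ℝ) ≤ Module.finrank ℂ H := Nat.cast_nonneg _
  obtain ⟨V, U, B, hT, hVU, hHV⟩ := hS H A hA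
    (fun i j => (hcom i j).trans (mul_le_mul_of_nonneg_right (min_le_left _ _) hd0))
  obtain ⟨m, hm⟩ := Nat.exists_eq_add_of_le (Submodule.finrank_mono hT.le)
  obtain ⟨A', hA', hcom', hlift⟩ := compress hA hT m hm
  have hUd : (Module.finrank ℂ U : ℝ) ≤ Module.finrank ℂ H := by exact_mod_cast Submodule.finrank_le U
  have hV' : (Module.finrank ℂ V : ℝ) + Module.finrank ℂ Vᗮ = Module.finrank ℂ H := by
    exact_mod_cast Submodule.finrank_add_finrank_orthogonal V
  have hmr : (Module.finrank ℂ V : ℝ) = Module.finrank ℂ U + m := by exact_mod_cast hm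
  generalize hd : (Module.finrank ℂ H : ℝ) = d at *
  have hmη : (m : ℝ) ≤ η * d := by nlinarith
  have hVc : c * d ≤ Module.finrank ℂ V := by
    calc c * d ≤ c * (2 * 4 ^ (Fintype.card σ + 1) * Module.finrank ℂ V) := mul_le_mul_of_nonneg_left hHV hc0.le
      _ = (c * (2 * 4 ^ (Fintype.card σ + 1))) * Module.finrank ℂ V := by ring
      _ = _ := by rw [hcK, one_mul]
  have hη1d : η * d ≤ c * ε / 8 * d := mul_le_mul_of_nonneg_right hη1 hd0
  by_cases hbig : γ * d ≤ Module.finrank ℂ Vᗮ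
  · obtain ⟨B', hB', hr⟩ := hP Vᗮ A' hA' (by
      intro i j
      have h1 : (rk (A' i * A' j - A' j * A' i) : ℝ) ≤ rk (A i * A j - A j * A i) + 2 * m := by
        exact_mod_cast hcom' i j
      have h2 := hcom i j
      have h3 : min δ₀ (δ' * γ / 2) * d ≤ δ' * γ / 2 * d := mul_le_mul_of_nonneg_right (min_le_right _ _) hd0
      have h4 : η * d ≤ δ' * γ / 4 * d := mul_le_mul_of_nonneg_right hη2 hd0
      have h5 := mul_le_mul_of_nonneg_left hbig hδ'.le
      linarith)
    obtain ⟨C, hC, hCr⟩ := hlift B' hB'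
    refine ⟨C, hC, fun i => ?_⟩
    have h1 : (rk (A i - C i) : ℝ) ≤ 2 * m + rk (A' i - B' i) := by exact_mod_cast hCr i
    have h2 := hr i
    have h3 : ε * (Module.finrank ℂ Vᗮ : ℝ) ≤ ε * (d - c * d) := mul_le_mul_of_nonneg_left (by linarith) hε.le
    have h4 : 0 ≤ c * ε * d := by positivity
    linarith
  · obtain ⟨C, hC, hCr⟩ := hlift 0 (fun i j => rfl)
    refine ⟨C, hC, fun i => ?_⟩
    have h1 : (rk (A i - C i) : ℝ) ≤ 2 * m + rk (A' i - 0) := by exact_mod_cast hCr i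
    have h2 : (rk (A' i - 0) : ℝ) ≤ Module.finrank ℂ Vᗮ := by exact_mod_cast rk_le _
    have h4 : 0 ≤ ε * d * (1 - c) := mul_nonneg (by positivity) (by linarith)
    have h5 : γ * d = c * ε / 4 * d := by rw [hγ]
    push Not at hbig
    linarith

lemma PP_all (σ : Type) [Fintype σ] {ε : ℝ} (hε : 0 < ε) : PP σ ε := by
  obtain ⟨r, hr⟩ : ∃ r : ℝ, r = 1 - 1 / (2 * 4 ^ (Fintype.card σ + 1)) / 2 := ⟨_, rfl⟩
  have hK1 : (1 : ℝ) ≤ 2 * 4 ^ (Fintype.card σ + 1) := by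
    have : (1:ℝ) ≤ 4 ^ (Fintype.card σ + 1) := one_le_pow₀ (by norm_num)
    linarith
  have h0 : 0 < 1 / (2 * 4 ^ (Fintype.card σ + 1) : ℝ) := by positivity
  have h1 : 1 / (2 * 4 ^ (Fintype.card σ + 1) : ℝ) ≤ 1 := (div_le_one (by linarith)).2 hK1
  have hr0 : 0 < r := by linarith
  have hr1 : r < 1 := by linarith
  have hk : ∀ k : ℕ, PP σ (r ^ k) := by
    intro k
    induction k with
    | zero => simpa using PP_one σ
    | succ k ih =>
      rw [pow_succ', hr]
      rw [hr] at ih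
      exact PP_step (by rw [← hr]; positivity) ih
  obtain ⟨k, hk'⟩ := exists_pow_lt_of_lt_one hε hr1
  exact PP_mono hk'.le (hk k)
lemma rk_comm4 {E : Type} [AddCommGroup E] [Module ℂ E] [FiniteDimensional ℂ E]
    (P Q R S : Module.End ℂ E) (a b c e : ℂ) (k : ℝ)
    (h1 : (rk (P * R - R * P) : ℝ) ≤ k) (h2 : (rk (P * S - S * P) : ℝ) ≤ k)
    (h3 : (rk (Q * R - R * Q) : ℝ) ≤ k) (h4 : (rk (Q * S - S * Q) : ℝ) ≤ k) :
    (rk ((a • P + b • Q) * (c • R + e • S) - (c • R + e • S) * (a • P + b • Q)) : ℝ) ≤ 4 * k := by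
  have e0 : (a • P + b • Q) * (c • R + e • S) - (c • R + e • S) * (a • P + b • Q)
      = ((a * c) • (P * R - R * P) + (a * e) • (P * S - S * P))
        + ((b * c) • (Q * R - R * Q) + (b * e) • (Q * S - S * Q)) := by
    simp only [mul_add, add_mul, smul_mul_smul_comm, smul_sub, mul_comm c, mul_comm e]
    abel
  rw [e0]
  have a1 := rk_add ((a * c) • (P * R - R * P) + (a * e) • (P * S - S * P))
    ((b * c) • (Q * R - R * Q) + (b * e) • (Q * S - S * Q))
  have a2 := rk_add ((a * c) • (P * R - R * P)) ((a * e) • (P * S - S * P))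
  have a3 := rk_add ((b * c) • (Q * R - R * Q)) ((b * e) • (Q * S - S * Q))
  have b1 := rk_smul (a * c) (P * R - R * P)
  have b2 := rk_smul (a * e) (P * S - S * P)
  have b3 := rk_smul (b * c) (Q * R - R * Q)
  have b4 := rk_smul (b * e) (Q * S - S * Q)
  have : (rk (((a * c) • (P * R - R * P) + (a * e) • (P * S - S * P))
        + ((b * c) • (Q * R - R * Q) + (b * e) • (Q * S - S * Q))) : ℝ) ≤
      rk (P * R - R * P) + rk (P * S - S * P) + rk (Q * R - R * Q) + rk (Q * S - S * Q) := by
    norm_cast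
    omega
  linarith

lemma rank_toMatrixOrthonormal {d : ℕ} (T : Module.End ℂ (EuclideanSpace ℂ (Fin d))) :
    (LinearMap.toMatrixOrthonormal (EuclideanSpace.basisFun (Fin d) ℂ) T).rank = rk T := by
  rw [Matrix.rank_eq_finrank_range_toLin _ (EuclideanSpace.basisFun (Fin d) ℂ).toBasis
    (EuclideanSpace.basisFun (Fin d) ℂ).toBasis]
  unfold rk
  have h : Matrix.toLin (EuclideanSpace.basisFun (Fin d) ℂ).toBasis (EuclideanSpace.basisFun (Fin d) ℂ).toBasis
      (LinearMap.toMatrixOrthonormal (EuclideanSpace.basisFun (Fin d) ℂ) T) = T :=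
    Matrix.toLin_toMatrix _ _ T
  rw [h]

/-- **Theorem.** For every `ε > 0` and `n ∈ ℕ₊` there exists `δ > 0` such that for all
`d ∈ ℕ₊`: every `∗`-closed `δ`-commuting tuple `𝒜` of `d×d` complex matrices admits a
commuting tuple `ℬ` with `d_rank(𝒜, ℬ) ≤ ε`. -/
theorem star_closed_almost_commuting_rank_metric
    (ε : ℝ) (hε : 0 < ε) (n : ℕ) (hn : 0 < n) :
    ∃ δ : ℝ, 0 < δ ∧
      ∀ (d : ℕ), 0 < d →
        ∀ A : Fin n → Matrix (Fin d) (Fin d) ℂ,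
          StarClosed A → DeltaCommuting δ A →
          ∃ B : Fin n → Matrix (Fin d) (Fin d) ℂ,
            (∀ i j, B i * B j = B j * B i) ∧
            ∀ i, nrank (A i - B i) ≤ ε := by
  obtain ⟨δ, hδ, hP⟩ := PP_all (Fin n ⊕ Fin n) (half_pos hε)
  refine ⟨δ / 4, by positivity, ?_⟩
  intro d hd A hstar hcom
  have hd' : (0 : ℝ) < d := by exact_mod_cast hd
  let Φ := LinearMap.toMatrixOrthonormal (EuclideanSpace.basisFun (Fin d) ℂ)
  have hrk : ∀ T, (Φ T).rank = rk T := rank_toMatrixOrthonormal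
  choose s hs using hstar
  let T : Fin n → Module.End ℂ (EuclideanSpace ℂ (Fin d)) := fun i => Φ.symm (A i)
  have hΦT : ∀ i, Φ (T i) = A i := fun i => Φ.apply_symm_apply (A i)
  have hTs : ∀ i, star (T i) = T (s i) := by
    intro i
    apply Φ.injective
    have h1 : Φ (star (T i)) = star (Φ (T i)) := map_star Φ (T i)
    have h2 : Φ (star (T i)) = Φ (T (s i)) := by
      rw [h1, hΦT, hΦT, ← hs]
      rfl
    exact h2
  have hTs' : ∀ i, star (T (s i)) = T i := fun i => by rw [← hTs, star_star]
  have hfr : Module.finrank ℂ (EuclideanSpace ℂ (Fin d)) = d := by simp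
  have hTc : ∀ i j, (rk (T i * T j - T j * T i) : ℝ) ≤ δ / 4 * d := by
    intro i j
    rw [← hrk, map_sub, map_mul, map_mul, hΦT, hΦT]
    have := hcom i j
    unfold nrank at this
    exact (div_le_iff₀ hd').1 this
  let a : Fin n ⊕ Fin n → ℂ := Sum.elim (fun _ => 1 / 2) (fun _ => - Complex.I / 2)
  let b : Fin n ⊕ Fin n → ℂ := Sum.elim (fun _ => 1 / 2) (fun _ => Complex.I / 2)
  let t : Fin n ⊕ Fin n → Fin n := Sum.elim id id
  obtain ⟨B, hB, hr⟩ := hP (EuclideanSpace ℂ (Fin d)) (fun x => a x • T (t x) + b x • T (s (t x))) (by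
    intro x
    rw [LinearMap.isSymmetric_iff_isSelfAdjoint]
    unfold IsSelfAdjoint
    rw [star_add, star_smul, star_smul, hTs, hTs', add_comm]
    rcases x with i | i <;> simp [a, b, t]) (by
    intro x y
    have := rk_comm4 (T (t x)) (T (s (t x))) (T (t y)) (T (s (t y))) (a x) (b x) (a y) (b y) _
      (hTc _ _) (hTc _ _) (hTc _ _) (hTc _ _)
    rw [hfr]
    refine this.trans (le_of_eq ?_)
    ring)
  refine ⟨fun i => Φ (B (Sum.inl i) + Complex.I • B (Sum.inr i)), ?_, ?_⟩
  · intro i j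
    rw [← map_mul, ← map_mul]
    congr 1
    simp only [mul_add, add_mul, smul_mul_assoc, mul_smul_comm, hB (Sum.inl i), hB (Sum.inr i)]
    module
  · intro i
    unfold nrank
    rw [div_le_iff₀ hd', ← hΦT i, ← map_sub, hrk]
    have e : T i - (B (Sum.inl i) + Complex.I • B (Sum.inr i)) =
        ((1 / 2 : ℂ) • T i + (1 / 2 : ℂ) • T (s i) - B (Sum.inl i))
        + Complex.I • ((- Complex.I / 2) • T i + (Complex.I / 2) • T (s i) - B (Sum.inr i)) := by
      have h1 : Complex.I * (- Complex.I / 2) = 1 / 2 := by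
        rw [mul_div_assoc', mul_neg, Complex.I_mul_I, neg_neg]
      have h2 : Complex.I * (Complex.I / 2) = - (1 / 2) := by
        rw [mul_div_assoc', Complex.I_mul_I, neg_div]
      rw [smul_sub, smul_add, smul_smul, smul_smul, h1, h2]
      module
    rw [e]
    have a1 := rk_add ((1 / 2 : ℂ) • T i + (1 / 2 : ℂ) • T (s i) - B (Sum.inl i))
      (Complex.I • ((- Complex.I / 2) • T i + (Complex.I / 2) • T (s i) - B (Sum.inr i)))
    have a2 := rk_smul Complex.I ((- Complex.I / 2) • T i + (Complex.I / 2) • T (s i) - B (Sum.inr i))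
    have a3 := hr (Sum.inl i)
    have a4 := hr (Sum.inr i)
    rw [hfr] at a3 a4
    change (rk ((1 / 2 : ℂ) • T i + (1 / 2 : ℂ) • T (s i) - B (Sum.inl i)) : ℝ) ≤ _ at a3
    change (rk ((- Complex.I / 2) • T i + (Complex.I / 2) • T (s i) - B (Sum.inr i)) : ℝ) ≤ _ at a4
    have a5 := a1.trans (Nat.add_le_add_left a2 _)
    have a6 : (_ : ℝ) ≤ _ := Nat.cast_le.2 a5
    push_cast at a6
    linarith
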